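/- For every integer m ≥ 1, setting n = 12m − 1, there exists a set S of n² points in ℝ² such that there are at least 3n+4 distinct lines each containing at least n points of S. -/

import Mathlib

/-- A line in the plane: a one-dimensional affine subspace of ℝ². -/
def IsLine (l : AffineSubspace ℝ (ℝ × ℝ)) : Prop :=
  Module.finrank ℝ l.direction = 1

/-- The line `A x + B y = C`. -/
noncomputable def lineOf (A B C : ℝ) : AffineSubspace ℝ (ℝ × ℝ) :=
  AffineSubspace.mk' (A * C / (A ^ 2 + B ^ 2), B * C / (A ^ 2 + B ^ 2))
    (Submodule.span ℝ {((-B, A) : ℝ × ℝ)})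

lemma normSq_ne {A B : ℝ} (h : A ≠ 0 ∨ B ≠ 0) : A ^ 2 + B ^ 2 ≠ 0 := by
  rcases h with h | h
  · have := sq_pos_of_ne_zero h
    nlinarith [sq_nonneg B]
  · have := sq_pos_of_ne_zero h
    nlinarith [sq_nonneg A]

lemma isLine_lineOf {A B : ℝ} (C : ℝ) (h : A ≠ 0 ∨ B ≠ 0) : IsLine (lineOf A B C) := by
  unfold IsLine lineOf
  rw [AffineSubspace.direction_mk']
  apply finrank_span_singleton
  intro h0
  simp only [Prod.mk_eq_zero, neg_eq_zero] at h0
  tauto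

lemma mem_lineOf {A B : ℝ} (C : ℝ) (h : A ≠ 0 ∨ B ≠ 0) (p : ℝ × ℝ) :
    p ∈ lineOf A B C ↔ A * p.1 + B * p.2 = C := by
  have hD := normSq_ne h
  obtain ⟨x, y⟩ := p
  unfold lineOf
  rw [AffineSubspace.mem_mk', Submodule.mem_span_singleton]
  simp only [vsub_eq_sub, Prod.mk_sub_mk, Prod.smul_mk, smul_eq_mul, Prod.mk.injEq]
  constructor
  · rintro ⟨a, h1, h2⟩
    have h1' : x = A * C / (A ^ 2 + B ^ 2) - a * B := by linarith
    have h2' : y = B * C / (A ^ 2 + B ^ 2) + a * A := by linarith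
    rw [h1', h2']
    field_simp
    ring
  · intro hC
    refine ⟨(A * y - B * x) / (A ^ 2 + B ^ 2), ?_, ?_⟩
    · rw [← hC]; field_simp; ring
    · rw [← hC]; field_simp; ring

lemma lineOf_inj {A B A' B' : ℝ} (h : A ≠ 0 ∨ B ≠ 0) (h' : A' ≠ 0 ∨ B' ≠ 0)
    (he : lineOf A B 1 = lineOf A' B' 1) : A = A' ∧ B = B' := by
  have hD := normSq_ne h
  have h1 : ((A / (A ^ 2 + B ^ 2), B / (A ^ 2 + B ^ 2)) : ℝ × ℝ) ∈ lineOf A B 1 := by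
    rw [mem_lineOf 1 h]; field_simp
  have h2 : ((A / (A ^ 2 + B ^ 2) - B, B / (A ^ 2 + B ^ 2) + A) : ℝ × ℝ) ∈ lineOf A B 1 := by
    rw [mem_lineOf 1 h]; field_simp; ring
  rw [he, mem_lineOf 1 h'] at h1 h2
  simp only at h1 h2
  have e1 : A' * B = B' * A := by linarith
  have e2 : A' * A + B' * B = A ^ 2 + B ^ 2 := by
    field_simp at h1; linarith
  constructor
  · apply mul_right_cancel₀ hD
    linear_combination (-A) * e2 - B * e1
  · apply mul_right_cancel₀ hD
    linear_combination (-B) * e2 + A * e1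

lemma sin_sub_zero {M k k' : ℕ} {t : ℝ} (hM : 0 < M) (ht : M * t = Real.pi) (hk : k < M)
    (hk' : k' < M) (h : Real.sin ((k : ℝ) * t - k' * t) = 0) : k = k' := by
  have hMr : (0 : ℝ) < M := by exact_mod_cast hM
  have ht0 : 0 < t := by
    by_contra hc
    nlinarith [Real.pi_pos]
  have h1 : (k : ℝ) < M := by exact_mod_cast hk
  have h2 : (k' : ℝ) < M := by exact_mod_cast hk'
  have h3 : (0 : ℝ) ≤ k := by positivity
  have h4 : (0 : ℝ) ≤ k' := by positivity
  rw [Real.sin_eq_zero_iff_of_lt_of_lt (by nlinarith) (by nlinarith)] at h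
  have : (k : ℝ) = k' := by
    apply mul_right_cancel₀ ht0.ne'
    linarith
  exact_mod_cast this

/-- Points on different axes are different. -/
lemma axis_inj {M k k' : ℕ} {t τ τ' : ℝ} (hM : 0 < M) (ht : M * t = Real.pi) (hk : k < M)
    (hk' : k' < M) (h0 : τ ≠ 0) (h0' : τ' ≠ 0)
    (h : (τ * Real.cos (k * t), τ * Real.sin (k * t))
      = (τ' * Real.cos (k' * t), τ' * Real.sin (k' * t))) : k = k' := by
  simp only [Prod.mk.injEq] at h
  obtain ⟨h1, h2⟩ := h
  apply sin_sub_zero hM ht hk hk'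
  rw [Real.sin_sub]
  have : τ * τ' * (Real.sin (k * t) * Real.cos (k' * t)
      - Real.cos (k * t) * Real.sin (k' * t)) = 0 := by
    linear_combination τ' * Real.cos (k' * t) * h2 - τ' * Real.sin (k' * t) * h1
  rcases mul_eq_zero.mp this with h | h
  · exact absurd h (mul_ne_zero h0 h0')
  · exact h

/-- Inradius of the side number `s`. -/
noncomputable def rad (t : ℝ) (s : ℕ) : ℝ := if Even s then 2 * Real.cos t else 1

/-- Indices of the points used on axis `k`. -/
def idx (m k : ℕ) : Finset ℕ :=
  if Even k then ((Finset.Icc 1 (12 * m - 1)).erase (6 * m - 1)).erase (6 * m + 1)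
  else ((Finset.Icc 1 (12 * m - 1)).erase 1).erase (12 * m - 1)

lemma card_idx {m : ℕ} (hm : 1 ≤ m) (k : ℕ) : (idx m k).card = 12 * m - 3 := by
  unfold idx
  split_ifs
  · rw [Finset.card_erase_of_mem, Finset.card_erase_of_mem, Nat.card_Icc]
    · omega
    · simp; omega
    · simp; omega
  · rw [Finset.card_erase_of_mem, Finset.card_erase_of_mem, Nat.card_Icc]
    · omega
    · simp; omega
    · simp; omega

lemma mid_mem_idx {m : ℕ} (hm : 1 ≤ m) (k : ℕ) : 6 * m ∈ idx m k := by
  unfold idx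
  split_ifs <;> simp <;> omega

/-- Every index can be replaced by one in `idx`. -/
lemma idx_reduce {m : ℕ} (hm : 1 ≤ m) {t : ℝ} (ht : 12 * m * t = Real.pi)
    (hc : 0 < Real.cos t) (k u : ℕ) (h1 : 1 ≤ u) (h2 : u ≤ 12 * m - 1) :
    ∃ v ∈ idx m k, Real.cos (u * t) / rad t (u + k) = Real.cos (v * t) / rad t (v + k) := by
  by_cases hu : u ∈ idx m k
  · exact ⟨u, hu, rfl⟩
  by_cases hk : Even k
  · have hu' : u = 6 * m - 1 ∨ u = 6 * m + 1 := by
      unfold idx at hu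
      simp [hk] at hu
      omega
    rcases hu' with rfl | rfl
    · refine ⟨6 * m - 2, ?_, ?_⟩
      · simp [idx, hk]; omega
      have e1 : ¬ Even (6 * m - 1 + k) := by
        rw [Nat.even_iff] at hk ⊢; omega
      have e2 : Even (6 * m - 2 + k) := by
        rw [Nat.even_iff] at hk ⊢; omega
      have c1 : Real.cos ((6 * m - 1 : ℕ) * t) = Real.sin t := by
        rw [← Real.cos_pi_div_two_sub]
        congr 1
        rw [Nat.cast_sub (by omega)]; push_cast; linarith
      have c2 : Real.cos ((6 * m - 2 : ℕ) * t) = Real.sin (2 * t) := by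
        rw [← Real.cos_pi_div_two_sub]
        congr 1
        rw [Nat.cast_sub (by omega)]; push_cast; linarith
      rw [c1, c2, Real.sin_two_mul]
      simp only [rad, e1, e2, if_true, if_false]
      field_simp
    · refine ⟨6 * m + 2, ?_, ?_⟩
      · simp [idx, hk]; omega
      have e1 : ¬ Even (6 * m + 1 + k) := by
        rw [Nat.even_iff] at hk ⊢; omega
      have e2 : Even (6 * m + 2 + k) := by
        rw [Nat.even_iff] at hk ⊢; omega
      have c1 : Real.cos ((6 * m + 1 : ℕ) * t) = - Real.sin t := by
        rw [← Real.cos_add_pi_div_two]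
        congr 1
        push_cast; linarith
      have c2 : Real.cos ((6 * m + 2 : ℕ) * t) = - Real.sin (2 * t) := by
        rw [← Real.cos_add_pi_div_two]
        congr 1
        push_cast; linarith
      rw [c1, c2, Real.sin_two_mul]
      simp only [rad, e1, e2, if_true, if_false]
      field_simp
  · have hu' : u = 1 ∨ u = 12 * m - 1 := by
      unfold idx at hu
      simp [hk] at hu
      omega
    rcases hu' with rfl | rfl
    · refine ⟨4 * m, ?_, ?_⟩
      · simp [idx, hk]; omega
      have e1 : Even (1 + k) := by
        rw [Nat.even_iff] at hk ⊢; omega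
      have e2 : ¬ Even (4 * m + k) := by
        rw [Nat.even_iff] at hk ⊢; omega
      have c2 : Real.cos ((4 * m : ℕ) * t) = 1 / 2 := by
        rw [← Real.cos_pi_div_three]
        congr 1
        push_cast; linarith
      rw [c2]
      simp only [rad, e1, e2, if_true, if_false]
      push_cast
      rw [one_mul]
      field_simp
    · refine ⟨8 * m, ?_, ?_⟩
      · simp [idx, hk]; omega
      have e1 : Even (12 * m - 1 + k) := by
        rw [Nat.even_iff] at hk ⊢; omega
      have e2 : ¬ Even (8 * m + k) := by
        rw [Nat.even_iff] at hk ⊢; omega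
      have c1 : Real.cos ((12 * m - 1 : ℕ) * t) = - Real.cos t := by
        rw [← Real.cos_pi_sub]
        congr 1
        rw [Nat.cast_sub (by omega)]; push_cast; linarith
      have c2 : Real.cos ((8 * m : ℕ) * t) = - (1 / 2) := by
        rw [← Real.cos_pi_div_three, ← Real.cos_pi_sub]
        congr 1
        push_cast; linarith
      rw [c1, c2]
      simp only [rad, e1, e2, if_true, if_false]
      field_simp

lemma rad_congr (t : ℝ) {a b : ℕ} (h : a % 2 = b % 2) : rad t a = rad t b := by
  simp only [rad, Nat.even_iff, h]

/-- The side `s` meets the axis `k` in one of the chosen points, unless at the foot. -/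
lemma side_axis {m : ℕ} (hm : 1 ≤ m) {t : ℝ} (ht : 12 * m * t = Real.pi)
    (hc : 0 < Real.cos t) (k s : ℕ) (hk : k < 12 * m) (hs : s < 2 * (12 * m))
    (hne : k ≠ s % (12 * m)) :
    ∃ v ∈ idx m k, Real.cos (k * t - s * t) / rad t s = Real.cos (v * t) / rad t (v + k) := by
  have hne1 : k ≠ s := by
    rintro rfl
    exact hne (Nat.mod_eq_of_lt hk).symm
  have hne2 : s ≠ k + 12 * m := by
    rintro rfl
    apply hne
    rw [Nat.add_mod_right, Nat.mod_eq_of_lt hk]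
  rcases lt_or_gt_of_ne hne1 with h | h
  · rcases lt_or_gt_of_ne hne2 with h' | h'
    · obtain ⟨v, hv, e⟩ := idx_reduce hm ht hc k (s - k) (by omega) (by omega)
      refine ⟨v, hv, ?_⟩
      rw [← e, rad_congr t (show s % 2 = (s - k + k) % 2 by omega), ← Real.cos_neg]
      congr 2
      rw [Nat.cast_sub h.le]; ring
    · obtain ⟨v, hv, e⟩ := idx_reduce hm ht hc k (24 * m + k - s) (by omega) (by omega)
      refine ⟨v, hv, ?_⟩
      rw [← e, rad_congr t (show s % 2 = (24 * m + k - s + k) % 2 by omega),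
        ← Real.cos_add_two_pi]
      congr 2
      rw [Nat.cast_sub (by omega)]; push_cast; linarith
  · obtain ⟨v, hv, e⟩ := idx_reduce hm ht hc k (k - s) (by omega) (by omega)
    refine ⟨v, hv, ?_⟩
    rw [← e, rad_congr t (show s % 2 = (k - s + k) % 2 by omega)]
    congr 2
    rw [Nat.cast_sub h.le]; ring

/-- A line meeting many axes in points of `S` off the origin is rich. -/
lemma rich_of_axes {M n : ℕ} {t : ℝ} (hM : 0 < M) (ht : M * t = Real.pi)
    (S : Finset (ℝ × ℝ)) (l : AffineSubspace ℝ (ℝ × ℝ)) (K : Finset ℕ) (hK : n ≤ K.card)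
    (τ : ℕ → ℝ) (h : ∀ k ∈ K, k < M ∧ τ k ≠ 0 ∧
      (τ k * Real.cos (k * t), τ k * Real.sin (k * t)) ∈ l ∧
      (τ k * Real.cos (k * t), τ k * Real.sin (k * t)) ∈ S) :
    n ≤ ((l : Set (ℝ × ℝ)) ∩ ↑S).ncard := by
  classical
  set f : ℕ → ℝ × ℝ := fun k => (τ k * Real.cos (k * t), τ k * Real.sin (k * t)) with hf
  have hinj : Set.InjOn f K := by
    intro a ha b hb hab
    exact axis_inj hM ht (h a ha).1 (h b hb).1 (h a ha).2.1 (h b hb).2.1 hab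
  rw [← Finset.card_image_of_injOn hinj] at hK
  refine hK.trans ?_
  rw [← Set.ncard_coe_finset]
  apply Set.ncard_le_ncard
  · intro p hp
    simp only [Finset.coe_image, Set.mem_image, Finset.mem_coe] at hp
    obtain ⟨k, hk, rfl⟩ := hp
    exact ⟨(h k hk).2.2.1, (h k hk).2.2.2⟩
  · exact S.finite_toSet.subset Set.inter_subset_right

/-- For every integer `m ≥ 1`, setting `n = 12m − 1`, there exists a set `S` of `n²`
points in ℝ² such that there are at least `3n+4` distinct lines each containing at
least `n` points of `S`. -/
theorem T_n_lower_bound (m : ℕ) (hm : 1 ≤ m) (n : ℕ) (hn : n = 12 * m - 1) :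
    ∃ S : Finset (ℝ × ℝ), S.card = n ^ 2 ∧
      ∃ L : Finset (AffineSubspace ℝ (ℝ × ℝ)), 3 * n + 4 ≤ L.card ∧
        ∀ l ∈ L, IsLine l ∧ n ≤ ((l : Set (ℝ × ℝ)) ∩ ↑S).ncard := by
  classical
  obtain ⟨M, hMdef⟩ : ∃ M, M = 12 * m := ⟨_, rfl⟩
  have hM : 0 < M := by omega
  have hm' : (1 : ℝ) ≤ m := by exact_mod_cast hm
  obtain ⟨t, ht⟩ : ∃ t : ℝ, 12 * m * t = Real.pi := ⟨Real.pi / (12 * m), by field_simp⟩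
  have htM : M * t = Real.pi := by rw [hMdef]; push_cast; exact ht
  have ht0 : 0 < t := by
    by_contra hc
    nlinarith [Real.pi_pos]
  have ht1 : t ≤ Real.pi / 12 := by nlinarith
  have hc2 : 1 / 2 < Real.cos t := by
    rw [← Real.cos_pi_div_three]
    apply Real.cos_lt_cos_of_nonneg_of_le_pi ht0.le <;> linarith [Real.pi_pos]
  have hc : 0 < Real.cos t := by linarith
  have hr : ∀ s, 1 ≤ rad t s := by
    intro s
    unfold rad
    split_ifs <;> linarith
  have hr0 : ∀ s, 0 < rad t s := fun s => by linarith [hr s]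
  -- choice of the projective chart
  set c : ℕ → ℝ := fun k => Real.cos (k * t - t / 2) with hcdef
  have hck : ∀ k < M, c k ≠ 0 := by
    intro k hk h0
    rw [hcdef] at h0
    simp only at h0
    rw [Real.cos_eq_zero_iff] at h0
    obtain ⟨j, hj⟩ := h0
    rw [← htM, hMdef] at hj
    have : ((2 * (k : ℤ) - 1 : ℤ) : ℝ) = ((2 * j + 1) * (12 * m) : ℤ) := by
      push_cast at hj ⊢
      apply mul_right_cancel₀ ht0.ne'
      linarith
    have h3 : (2 * (k : ℤ) - 1 : ℤ) = (2 * j + 1) * (12 * m) := by exact_mod_cast this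
    have h4 : (2 * (k : ℤ) - 1 : ℤ) = 2 * ((2 * j + 1) * (6 * m)) := by rw [h3]; ring
    omega
  obtain ⟨R, hR⟩ : ∃ R : ℝ, ∀ k < M, 1 < |R * c k| := by
    refine ⟨∑ k ∈ Finset.range M, 2 / |c k|, ?_⟩
    intro k hk
    have hp : 0 < |c k| := abs_pos.mpr (hck k hk)
    have h1 : 2 / |c k| ≤ ∑ k ∈ Finset.range M, 2 / |c k| :=
      Finset.single_le_sum (f := fun k => 2 / |c k|) (fun i _ => by positivity)
        (Finset.mem_range.mpr hk)
    rw [abs_mul]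
    have h2 := h1.trans (le_abs_self _)
    rw [div_le_iff₀ hp] at h2
    linarith
  set a := R * Real.cos (t / 2) with ha
  set b := R * Real.sin (t / 2) with hb
  have hlam : ∀ k : ℕ, a * Real.cos (k * t) + b * Real.sin (k * t) = R * c k := by
    intro k
    rw [hcdef]
    simp only
    rw [Real.cos_sub, ha, hb]; ring
  set w : ℕ → ℕ → ℝ := fun k u => Real.cos (u * t) / rad t (u + k) with hw
  have hcr : ∀ x s, |Real.cos x / rad t s| ≤ 1 := by
    intro x s
    rw [abs_div, abs_of_pos (hr0 s), div_le_one (hr0 s)]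
    exact (Real.abs_cos_le_one x).trans (hr s)
  have hne : ∀ k < M, ∀ x s, R * c k + Real.cos x / rad t s ≠ 0 := by
    intro k hk x s h0
    have h1 := hR k hk
    have h2 := hcr x s
    have h3 : R * c k = - (Real.cos x / rad t s) := by linarith
    rw [h3, abs_neg] at h1
    linarith
  -- the points
  have hT : ∀ k, ∃ T : Finset ℝ, insert 0 ((idx m k).image fun u => (R * c k + w k u)⁻¹) ⊆ T ∧
      T.card = n := by
    intro k
    apply Infinite.exists_superset_card_eq
    refine (Finset.card_insert_le _ _).trans ?_
    have := Finset.card_image_le (s := idx m k) (f := fun u => (R * c k + w k u)⁻¹)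
    rw [card_idx hm] at this
    omega
  choose T hTs hTc using hT
  have hT0 : ∀ k, 0 ∈ T k := fun k => hTs k (Finset.mem_insert_self _ _)
  set pt : ℕ → ℝ → ℝ × ℝ := fun k τ => (τ * Real.cos (k * t), τ * Real.sin (k * t)) with hpt
  obtain ⟨S, hS0, hSc⟩ : ∃ S : Finset (ℝ × ℝ),
      insert (0 : ℝ × ℝ) ((Finset.range M).biUnion fun k => ((T k).erase 0).image (pt k)) ⊆ S ∧
      S.card = n ^ 2 := by
    apply Infinite.exists_superset_card_eq
    refine (Finset.card_insert_le _ _).trans ?_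
    have h1 : ((Finset.range M).biUnion fun k => ((T k).erase 0).image (pt k)).card
        ≤ (Finset.range M).card * (n - 1) := by
      apply Finset.card_biUnion_le_card_mul
      intro k _
      refine Finset.card_image_le.trans ?_
      rw [Finset.card_erase_of_mem (hT0 k), hTc k]
    rw [Finset.card_range] at h1
    obtain ⟨q, rfl⟩ : ∃ q, n = q + 1 := ⟨n - 1, by omega⟩
    have hMq : M = q + 2 := by omega
    have h2 : M * (q + 1 - 1) = (q + 2) * q := by rw [hMq, Nat.add_sub_cancel]
    rw [h2] at h1
    nlinarith
  have hS : ∀ k < M, ∀ τ ∈ T k, pt k τ ∈ S := by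
    intro k hk τ hτ
    apply hS0
    by_cases h0 : τ = 0
    · subst h0
      simp [hpt]
    · apply Finset.mem_insert_of_mem
      rw [Finset.mem_biUnion]
      exact ⟨k, Finset.mem_range.mpr hk, Finset.mem_image_of_mem _
        (Finset.mem_erase.mpr ⟨h0, hτ⟩)⟩
  have hSw : ∀ k < M, ∀ u ∈ idx m k, pt k (R * c k + w k u)⁻¹ ∈ S := by
    intro k hk u hu
    apply hS k hk
    apply hTs k
    exact Finset.mem_insert_of_mem (Finset.mem_image_of_mem _ hu)
  -- the lines
  set ax : ℕ → AffineSubspace ℝ (ℝ × ℝ) :=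
    fun k => lineOf (Real.sin (k * t)) (-Real.cos (k * t)) 0 with hax
  set sd : ℕ → AffineSubspace ℝ (ℝ × ℝ) :=
    fun s => lineOf (a + Real.cos (s * t) / rad t s) (b + Real.sin (s * t) / rad t s) 1 with hsd
  have hax0 : ∀ k : ℕ, Real.sin (k * t) ≠ 0 ∨ -Real.cos (k * t) ≠ 0 := by
    intro k
    by_contra! hcon
    have := Real.sin_sq_add_cos_sq (k * t)
    rw [hcon.1, neg_eq_zero.mp hcon.2] at this
    norm_num at this
  have hsdk : ∀ k s : ℕ, (a + Real.cos (s * t) / rad t s) * Real.cos (k * t) +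
      (b + Real.sin (s * t) / rad t s) * Real.sin (k * t)
      = R * c k + Real.cos (k * t - s * t) / rad t s := by
    intro k s
    rw [Real.cos_sub, ← hlam]; ring
  have hsd0 : ∀ s : ℕ, a + Real.cos (s * t) / rad t s ≠ 0 ∨
      b + Real.sin (s * t) / rad t s ≠ 0 := by
    intro s
    by_contra! hcon
    have h1 := hsdk 0 s
    rw [hcon.1, hcon.2] at h1
    exact hne 0 hM _ s (by rw [← h1]; ring)
  have hinf0 : a ≠ 0 ∨ b ≠ 0 := by
    by_contra! hcon
    have h1 := hlam 0
    rw [hcon.1, hcon.2] at h1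
    have h2 := hR 0 hM
    rw [← h1] at h2
    norm_num at h2
  have haxinj : Set.InjOn ax (Finset.range M : Finset ℕ) := by
    intro k hk k' hk' he
    simp only [Finset.coe_range, Set.mem_Iio] at hk hk'
    have h1 : ((Real.cos (k * t), Real.sin (k * t)) : ℝ × ℝ) ∈ ax k := by
      rw [hax, mem_lineOf _ (hax0 k)]
      simp only; ring
    rw [he, hax, mem_lineOf _ (hax0 k')] at h1
    simp only at h1
    apply sin_sub_zero hM htM hk hk'
    rw [Real.sin_sub]; linarith
  have hsdinj : Set.InjOn sd (Finset.range (2 * M) : Finset ℕ) := by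
    intro s hs s' hs' he
    simp only [Finset.coe_range, Set.mem_Iio] at hs hs'
    obtain ⟨e1, e2⟩ := lineOf_inj (hsd0 s) (hsd0 s') he
    have e1 : Real.cos (s * t) / rad t s = Real.cos (s' * t) / rad t s' := by linarith
    have e2 : Real.sin (s * t) / rad t s = Real.sin (s' * t) / rad t s' := by linarith
    have hp := hr0 s
    have hp' := hr0 s'
    rw [div_eq_div_iff hp.ne' hp'.ne'] at e1 e2
    have h1 := Real.sin_sq_add_cos_sq (s * t)
    have h2 := Real.sin_sq_add_cos_sq (s' * t)
    have h3 : rad t s' ^ 2 = rad t s ^ 2 := by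
      calc rad t s' ^ 2 = (Real.sin (s * t) * rad t s') ^ 2 + (Real.cos (s * t) * rad t s') ^ 2 := by
            linear_combination (-rad t s' ^ 2) * h1
        _ = rad t s ^ 2 := by
            rw [e1, e2]; linear_combination (rad t s ^ 2) * h2
    have h4 : rad t s' = rad t s := (sq_eq_sq₀ hp'.le hp.le).mp h3
    rw [h4] at e1 e2
    have e1 := mul_right_cancel₀ hp.ne' e1
    have e2 := mul_right_cancel₀ hp.ne' e2
    have h5 : Real.cos (s * t - s' * t) = 1 := by
      rw [Real.cos_sub, e1, e2]; linarith
    have hsr : (s : ℝ) < 2 * M := by exact_mod_cast hs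
    have hsr' : (s' : ℝ) < 2 * M := by exact_mod_cast hs'
    have hs0 : (0 : ℝ) ≤ s := by positivity
    have hs0' : (0 : ℝ) ≤ s' := by positivity
    rw [Real.cos_eq_one_iff_of_lt_of_lt (by nlinarith) (by nlinarith)] at h5
    have : (s : ℝ) = s' := by
      apply mul_right_cancel₀ ht0.ne'
      linarith
    exact_mod_cast this
  have hinfsd : lineOf a b 1 ∉ (Finset.range (2 * M)).image sd := by
    intro hmem
    rw [Finset.mem_image] at hmem
    obtain ⟨s, _, he⟩ := hmem
    obtain ⟨e1, e2⟩ := lineOf_inj (hsd0 s) hinf0 he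
    have hp := hr0 s
    have e1 : Real.cos (s * t) / rad t s = 0 := by linarith
    have e2 : Real.sin (s * t) / rad t s = 0 := by linarith
    have h1 := Real.sin_sq_add_cos_sq (s * t)
    rw [div_eq_zero_iff, or_iff_left hp.ne'] at e1 e2
    rw [e1, e2] at h1
    norm_num at h1
  have hdisj : Disjoint ((Finset.range M).image ax)
      (insert (lineOf a b 1) ((Finset.range (2 * M)).image sd)) := by
    rw [Finset.disjoint_left]
    intro l hl hl'
    rw [Finset.mem_image] at hl
    obtain ⟨k, _, rfl⟩ := hl
    have h0 : (0 : ℝ × ℝ) ∈ ax k := by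
      rw [hax, mem_lineOf _ (hax0 k)]; simp
    rw [Finset.mem_insert, Finset.mem_image] at hl'
    rcases hl' with h | ⟨s, _, h⟩
    · rw [h, mem_lineOf _ hinf0] at h0
      simp at h0
    · rw [← h, hsd, mem_lineOf _ (hsd0 s)] at h0
      simp at h0
  refine ⟨S, hSc, (Finset.range M).image ax ∪
      insert (lineOf a b 1) ((Finset.range (2 * M)).image sd), ?_, ?_⟩
  · rw [Finset.card_union_of_disjoint hdisj, Finset.card_insert_of_notMem hinfsd,
      Finset.card_image_of_injOn haxinj, Finset.card_image_of_injOn hsdinj,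
      Finset.card_range, Finset.card_range]
    omega
  intro l hl
  rw [Finset.mem_union, Finset.mem_insert, Finset.mem_image, Finset.mem_image] at hl
  rcases hl with ⟨k, hk, rfl⟩ | rfl | ⟨s, hs, rfl⟩
  · -- axes
    refine ⟨isLine_lineOf _ (hax0 k), ?_⟩
    rw [Finset.mem_range] at hk
    have hinj : Function.Injective (pt k) := by
      intro x y hxy
      simp only [hpt, Prod.mk.injEq] at hxy
      rcases hax0 k with h | h
      · exact mul_right_cancel₀ h hxy.2
      · exact mul_right_cancel₀ (neg_ne_zero.mp h) hxy.1
    calc n = ((T k).image (pt k)).card := by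
            rw [Finset.card_image_of_injective _ hinj, hTc]
      _ = (((T k).image (pt k) : Finset (ℝ × ℝ)) : Set (ℝ × ℝ)).ncard :=
            (Set.ncard_coe_finset _).symm
      _ ≤ _ := by
        apply Set.ncard_le_ncard
        · intro p hp
          simp only [Finset.coe_image, Set.mem_image, Finset.mem_coe] at hp
          obtain ⟨τ, hτ, rfl⟩ := hp
          refine ⟨?_, hS k hk τ hτ⟩
          rw [SetLike.mem_coe, hax, mem_lineOf _ (hax0 k)]
          simp only [hpt]; ring
        · exact S.finite_toSet.subset Set.inter_subset_right
  · -- the image of the line at infinity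
    refine ⟨isLine_lineOf _ hinf0, ?_⟩
    apply rich_of_axes hM htM S _ (Finset.range M) (by rw [Finset.card_range]; omega)
      (fun k => (R * c k + w k (6 * m))⁻¹)
    intro k hk
    rw [Finset.mem_range] at hk
    have hz := hne k hk ((6 * m : ℕ) * t) (6 * m + k)
    refine ⟨hk, inv_ne_zero hz, ?_, hSw k hk _ (mid_mem_idx hm k)⟩
    have hw0 : w k (6 * m) = 0 := by
      have : Real.cos ((6 * m : ℕ) * t) = 0 := by
        rw [← Real.cos_pi_div_two]
        congr 1
        push_cast; linarith
      simp only [hw, this, zero_div]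
    have hw1 : R * c k + w k (6 * m) ≠ 0 := hz
    rw [hw0, add_zero] at hw1
    rw [mem_lineOf _ hinf0]
    simp only [hw0, add_zero]
    have hi := mul_inv_cancel₀ hw1
    have hk2 := hlam k
    generalize (R * c k)⁻¹ = z at hi ⊢
    linear_combination hi + z * hk2
  · -- sides
    refine ⟨isLine_lineOf _ (hsd0 s), ?_⟩
    rw [Finset.mem_range] at hs
    apply rich_of_axes hM htM S _ ((Finset.range M).erase (s % M)) ?_
      (fun k => (R * c k + Real.cos (k * t - s * t) / rad t s)⁻¹)
    · intro k hk
      rw [Finset.mem_erase, Finset.mem_range] at hk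
      obtain ⟨hks, hk⟩ := hk
      have hz := hne k hk (k * t - s * t) s
      refine ⟨hk, inv_ne_zero hz, ?_, ?_⟩
      · rw [hsd, mem_lineOf _ (hsd0 s)]
        have hi := mul_inv_cancel₀ hz
        have hk2 := hsdk k s
        simp only
        generalize (R * c k + Real.cos (k * t - s * t) / rad t s)⁻¹ = z at hi ⊢
        linear_combination hi + z * hk2
      · obtain ⟨v, hv, e⟩ := side_axis hm ht hc k s (by omega) (by omega) (by rw [← hMdef]; exact hks)
        have := hSw k hk v hv
        simp only [hw, hpt, ← e] at this
        exact this
    · rw [Finset.card_erase_of_mem (Finset.mem_range.mpr (Nat.mod_lt _ hM)), Finset.card_range]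
      omega
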